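/- Let D be a p×p diagonal matrix with positive diagonal and D_min := min_i D(i,i), and let R be a symmetric real p×p matrix with zero diagonal and ‖R̄‖ ≤ α < 1, where R̄ is the entrywise absolute value of R. Let J = D^{1/2}(I−R)D^{1/2}. Then: (1) every principal submatrix J(B,B) of J is positive definite with smallest eigenvalue at least D_min(1−α); and (2) fix i ≠ j, set A = {i,j} and K(i,j) := ‖J(V∖{i,j}, {i,j})‖², and suppose D_min(1−α)|J(i,j)|/K(i,j) > 1+δ for some δ > 0. Then for every subset S ⊆ V∖{i,j} with B = V∖(S ∪ A), the marginal potential matrix J̃(A,A) := J(A,A) − J(A,B) J(B,B)^{-1} J(B,A) satisfies |J̃(i,j)| > (δ/(1+δ)) |J(i,j)|. -/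

import Mathlib

/-- The spectral norm (operator 2-norm) of a real matrix, viewed as a linear map
between Euclidean spaces. -/
noncomputable def spec {m n : Type*} [Fintype m] [Fintype n] [DecidableEq n]
    (A : Matrix m n ℝ) : ℝ :=
  ‖LinearMap.toContinuousLinearMap
    ((Matrix.toLin (PiLp.basisFun 2 ℝ n) (PiLp.basisFun 2 ℝ m)) A)‖

/-- The unnormalized precision matrix `J = D^{1/2} (I - R) D^{1/2}` with `D = diagonal d`. -/
noncomputable def Jmat {p : ℕ} (d : Fin p → ℝ) (R : Matrix (Fin p) (Fin p) ℝ) :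
    Matrix (Fin p) (Fin p) ℝ :=
  Matrix.diagonal (fun a => Real.sqrt (d a)) * (1 - R) *
    Matrix.diagonal (fun a => Real.sqrt (d a))

open Matrix

theorem spec_nonneg {m n : Type*} [Fintype m] [Fintype n] [DecidableEq n]
    (A : Matrix m n ℝ) : 0 ≤ spec A :=
  norm_nonneg _

/-- The spectral norm bounds the Euclidean length of `A *ᵥ x`. -/
theorem mulVec_dotProduct_self_le {m n : Type*} [Fintype m] [Fintype n] [DecidableEq n]
    (A : Matrix m n ℝ) (x : n → ℝ) :
    (A *ᵥ x) ⬝ᵥ (A *ᵥ x) ≤ spec A ^ 2 * (x ⬝ᵥ x) := by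
  have key := (LinearMap.toContinuousLinearMap
    ((Matrix.toLin (PiLp.basisFun 2 ℝ n) (PiLp.basisFun 2 ℝ m)) A)).le_opNorm (WithLp.toLp 2 x)
  have happ : LinearMap.toContinuousLinearMap
      ((Matrix.toLin (PiLp.basisFun 2 ℝ n) (PiLp.basisFun 2 ℝ m)) A) (WithLp.toLp 2 x)
      = WithLp.toLp 2 (A *ᵥ x) := rfl
  rw [happ] at key
  have hsq := pow_le_pow_left₀ (norm_nonneg _) key 2
  rw [mul_pow, EuclideanSpace.real_norm_sq_eq, EuclideanSpace.real_norm_sq_eq] at hsq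
  simpa [dotProduct, spec, sq] using hsq

theorem dotProduct_sq_le {n : Type*} [Fintype n] (x y : n → ℝ) :
    (x ⬝ᵥ y) ^ 2 ≤ (x ⬝ᵥ x) * (y ⬝ᵥ y) := by
  simpa [dotProduct, sq] using Finset.sum_mul_sq_le_sq_mul_sq Finset.univ x y

theorem dotProduct_self_nonneg_real {n : Type*} [Fintype n] (x : n → ℝ) : 0 ≤ x ⬝ᵥ x :=
  Finset.sum_nonneg fun _ _ => mul_self_nonneg _

theorem dotProduct_mulVec_le_spec {n : Type*} [Fintype n] [DecidableEq n]
    (A : Matrix n n ℝ) (x : n → ℝ) :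
    x ⬝ᵥ (A *ᵥ x) ≤ spec A * (x ⬝ᵥ x) := by
  have hx := dotProduct_self_nonneg_real x
  refine le_of_sq_le_sq ?_ (mul_nonneg (spec_nonneg A) hx)
  calc (x ⬝ᵥ (A *ᵥ x)) ^ 2 ≤ (x ⬝ᵥ x) * ((A *ᵥ x) ⬝ᵥ (A *ᵥ x)) := dotProduct_sq_le _ _
    _ ≤ (x ⬝ᵥ x) * (spec A ^ 2 * (x ⬝ᵥ x)) :=
      mul_le_mul_of_nonneg_left (mulVec_dotProduct_self_le A x) hx
    _ = (spec A * (x ⬝ᵥ x)) ^ 2 := by ring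

theorem dotProduct_mulVec_le_spec_abs {n : Type*} [Fintype n] [DecidableEq n]
    (R : Matrix n n ℝ) (x : n → ℝ) :
    x ⬝ᵥ (R *ᵥ x) ≤ spec (Matrix.of fun i j => |R i j|) * (x ⬝ᵥ x) := by
  have h := dotProduct_mulVec_le_spec (Matrix.of fun i j => |R i j|) (fun i => |x i|)
  have habs : (fun i => |x i|) ⬝ᵥ (fun i => |x i|) = x ⬝ᵥ x := by
    simp [dotProduct, abs_mul_abs_self]
  rw [habs] at h
  refine le_trans ?_ h
  simp only [dotProduct, mulVec, Finset.mul_sum, Matrix.of_apply]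
  refine Finset.sum_le_sum fun i _ => Finset.sum_le_sum fun j _ => ?_
  simpa only [abs_mul] using le_abs_self (x i * (R i j * x j))

theorem Jmat_isSymm {p : ℕ} (d : Fin p → ℝ) {R : Matrix (Fin p) (Fin p) ℝ} (hR : R.IsSymm) :
    (Jmat d R).IsSymm := by
  simp [Jmat, Matrix.IsSymm, Matrix.transpose_mul, hR.eq, Matrix.mul_assoc]

theorem le_dotProduct_Jmat_mulVec {p : ℕ} [NeZero p] {d : Fin p → ℝ} (hd : ∀ i, 0 < d i)
    {R : Matrix (Fin p) (Fin p) ℝ} {α : ℝ}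
    (hα : spec (Matrix.of fun i j => |R i j|) ≤ α) (hα1 : α < 1) (x : Fin p → ℝ) :
    Finset.univ.inf' Finset.univ_nonempty d * (1 - α) * (x ⬝ᵥ x) ≤
      x ⬝ᵥ (Jmat d R *ᵥ x) := by
  set y : Fin p → ℝ := Matrix.diagonal (fun a => Real.sqrt (d a)) *ᵥ x with hy
  have hquad : x ⬝ᵥ (Jmat d R *ᵥ x) = y ⬝ᵥ y - y ⬝ᵥ (R *ᵥ y) := by
    rw [Jmat, ← Matrix.mulVec_mulVec, ← hy, ← Matrix.mulVec_mulVec, Matrix.dotProduct_mulVec,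
      ← Matrix.mulVec_transpose, Matrix.diagonal_transpose, ← hy, Matrix.sub_mulVec,
      Matrix.one_mulVec, dotProduct_sub]
  have hR : y ⬝ᵥ (R *ᵥ y) ≤ α * (y ⬝ᵥ y) :=
    (dotProduct_mulVec_le_spec_abs R y).trans
      (mul_le_mul_of_nonneg_right hα (dotProduct_self_nonneg_real y))
  have hmin : Finset.univ.inf' Finset.univ_nonempty d * (x ⬝ᵥ x) ≤ y ⬝ᵥ y := by
    simp only [dotProduct, Finset.mul_sum, hy, Matrix.mulVec_diagonal]
    refine Finset.sum_le_sum fun a _ => ?_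
    have h1 := Finset.inf'_le d (Finset.mem_univ a)
    calc _ ≤ d a * (x a * x a) := mul_le_mul_of_nonneg_right h1 (mul_self_nonneg _)
      _ = (Real.sqrt (d a) * Real.sqrt (d a)) * (x a * x a) := by
        rw [Real.mul_self_sqrt (hd a).le]
      _ = _ := by ring
  rw [hquad]
  nlinarith

/-- A lower bound on a quadratic form passes to principal submatrices. -/
theorem le_dotProduct_submatrix_mulVec {m n : Type*} [Fintype m] [Fintype n]
    [DecidableEq n] {M : Matrix n n ℝ} {c : ℝ}
    (hM : ∀ x : n → ℝ, c * (x ⬝ᵥ x) ≤ x ⬝ᵥ (M *ᵥ x)) {f : m → n}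
    (hf : Function.Injective f) (x : m → ℝ) :
    c * (x ⬝ᵥ x) ≤ x ⬝ᵥ (M.submatrix f f *ᵥ x) := by
  classical
  set P : Matrix n m ℝ := (1 : Matrix n n ℝ).submatrix id f with hP
  have hsub (N : Matrix n n ℝ) : N.submatrix f f = Pᵀ * (N * P) := by
    ext a b
    simp [hP, Matrix.mul_apply, Matrix.one_apply]
  have hquad (N : Matrix n n ℝ) :
      x ⬝ᵥ (N.submatrix f f *ᵥ x) = (P *ᵥ x) ⬝ᵥ (N *ᵥ (P *ᵥ x)) := by
    rw [hsub, ← Matrix.mulVec_mulVec, ← Matrix.mulVec_mulVec, Matrix.dotProduct_mulVec,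
      Matrix.vecMul_transpose]
  have hone := hquad 1
  rw [Matrix.submatrix_one f hf, Matrix.one_mulVec, Matrix.one_mulVec] at hone
  rw [hquad, hone]
  exact hM _

theorem posDef_of_le_dotProduct_mulVec {n : Type*} [Fintype n] {M : Matrix n n ℝ}
    (hsym : M.IsSymm) {c : ℝ} (hc : 0 < c)
    (hM : ∀ x : n → ℝ, c * (x ⬝ᵥ x) ≤ x ⬝ᵥ (M *ᵥ x)) : M.PosDef := by
  refine Matrix.PosDef.of_dotProduct_mulVec_pos (by simpa [Matrix.IsHermitian] using hsym.eq)
    fun x hx => ?_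
  have hpos : 0 < x ⬝ᵥ x :=
    lt_of_le_of_ne (dotProduct_self_nonneg_real x) fun h => hx (dotProduct_self_eq_zero.1 h.symm)
  simpa using (mul_pos hc hpos).trans_le (hM x)

theorem le_of_mem_spectrum_of_le_dotProduct_mulVec {n : Type*} [Fintype n] [DecidableEq n]
    {M : Matrix n n ℝ} {c : ℝ} (hM : ∀ x : n → ℝ, c * (x ⬝ᵥ x) ≤ x ⬝ᵥ (M *ᵥ x))
    {μ : ℝ} (hμ : μ ∈ spectrum ℝ M) : c ≤ μ := by
  rw [← Matrix.spectrum_toLin', ← Module.End.hasEigenvalue_iff_mem_spectrum] at hμ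
  obtain ⟨x, hx⟩ := hμ.exists_hasEigenvector
  have heq : M *ᵥ x = μ • x := by simpa using hx.apply_eq_smul
  have hpos : 0 < x ⬝ᵥ x :=
    lt_of_le_of_ne (dotProduct_self_nonneg_real x) fun h => hx.2 (dotProduct_self_eq_zero.1 h.symm)
  have h := hM x
  rw [heq, dotProduct_smul, smul_eq_mul] at h
  exact le_of_mul_le_mul_right h hpos

/-- Bound on a bilinear form of the inverse of a matrix with quadratic form at least `c`. -/
theorem mul_abs_dotProduct_inv_mulVec_le {n : Type*} [Fintype n] [DecidableEq n]
    {M : Matrix n n ℝ} (hdet : IsUnit M.det) {c : ℝ} (hc : 0 < c)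
    (hM : ∀ x : n → ℝ, c * (x ⬝ᵥ x) ≤ x ⬝ᵥ (M *ᵥ x)) {u v : n → ℝ} {K : ℝ} (hK : 0 ≤ K)
    (hu : u ⬝ᵥ u ≤ K) (hv : v ⬝ᵥ v ≤ K) : c * |u ⬝ᵥ (M⁻¹ *ᵥ v)| ≤ K := by
  set w := M⁻¹ *ᵥ v with hw
  have hMw : M *ᵥ w = v := by
    rw [hw, Matrix.mulVec_mulVec, Matrix.mul_nonsing_inv _ hdet, Matrix.one_mulVec]
  have hww := dotProduct_self_nonneg_real w
  have hcw : c ^ 2 * (w ⬝ᵥ w) ≤ K := by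
    have h1 := hM w
    rw [hMw] at h1
    have h2 : (c * (w ⬝ᵥ w)) ^ 2 ≤ (w ⬝ᵥ w) * (v ⬝ᵥ v) :=
      (pow_le_pow_left₀ (mul_nonneg hc.le hww) h1 2).trans (dotProduct_sq_le w v)
    rcases hww.eq_or_lt with h0 | h0
    · rw [← h0, mul_zero]
      exact hK
    · refine le_trans (le_of_mul_le_mul_left ?_ h0) hv
      linarith
  refine le_of_sq_le_sq ?_ hK
  calc (c * |u ⬝ᵥ w|) ^ 2 = c ^ 2 * (u ⬝ᵥ w) ^ 2 := by rw [mul_pow, sq_abs]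
    _ ≤ c ^ 2 * ((u ⬝ᵥ u) * (w ⬝ᵥ w)) :=
      mul_le_mul_of_nonneg_left (dotProduct_sq_le u w) (sq_nonneg c)
    _ = (u ⬝ᵥ u) * (c ^ 2 * (w ⬝ᵥ w)) := by ring
    _ ≤ K * K := mul_le_mul hu hcw (by positivity) hK
    _ = K ^ 2 := (sq K).symm

theorem col_dotProduct_self_le_spec_sq {m n : Type*} [Fintype m] [Fintype n] [DecidableEq n]
    (A : Matrix m n ℝ) (k : n) : (fun a => A a k) ⬝ᵥ (fun a => A a k) ≤ spec A ^ 2 := by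
  have h := mulVec_dotProduct_self_le A (Pi.single k 1)
  rw [Matrix.mulVec_single_one] at h
  rwa [dotProduct_single_one, Pi.single_eq_same, mul_one] at h

theorem dotProduct_self_comp_le {m n : Type*} [Fintype m] [Fintype n] {f : m → n}
    (hf : Function.Injective f) (x : n → ℝ) : (x ∘ f) ⬝ᵥ (x ∘ f) ≤ x ⬝ᵥ x := by
  classical
  calc ∑ a, x (f a) * x (f a) = ∑ b ∈ Finset.univ.image f, x b * x b :=
      (Finset.sum_image (f := fun b => x b * x b) fun _ _ _ _ h => hf h).symm
    _ ≤ _ := Finset.sum_le_sum_of_subset_of_nonneg (Finset.subset_univ _)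
      fun _ _ _ => mul_self_nonneg _

/-- **Marginal precision matrix between neighbors under walk-summability.**
Let `D = diagonal d` with positive diagonal, `D_min = min_i d i`, and let `R` be symmetric
with zero diagonal and `‖R̄‖ ≤ α < 1`.  Put `J = D^{1/2}(I-R)D^{1/2}`.  Then
(1) every principal submatrix `J(B,B)` is positive definite with smallest eigenvalue at
least `D_min (1-α)`, and (2) if `i ≠ j`, `K(i,j) = ‖J(V∖{i,j},{i,j})‖²` and
`D_min (1-α) |J(i,j)| / K(i,j) > 1 + δ` with `δ > 0`, then for every `S ⊆ V∖{i,j}`, with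
`B = V∖(S ∪ {i,j})`, the marginal potential matrix
`J̃ = J(A,A) - J(A,B) J(B,B)⁻¹ J(B,A)` (with `A = {i,j}`) satisfies
`|J̃(i,j)| > (δ/(1+δ)) |J(i,j)|`. -/
theorem stmt_6 {p : ℕ} [NeZero p] (d : Fin p → ℝ) (hd : ∀ i, 0 < d i)
    (R : Matrix (Fin p) (Fin p) ℝ) (hsym : R.IsSymm) (hdiag : ∀ i, R i i = 0)
    (α : ℝ) (hα : spec (Matrix.of fun i j => |R i j|) ≤ α) (hα1 : α < 1) :
    (∀ B : Finset (Fin p),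
      (((Jmat d R).submatrix (Subtype.val : {v : Fin p // v ∈ B} → Fin p)
          Subtype.val).PosDef) ∧
      ∀ lam : ℝ, lam ∈ spectrum ℝ ((Jmat d R).submatrix
          (Subtype.val : {v : Fin p // v ∈ B} → Fin p)
          (Subtype.val : {v : Fin p // v ∈ B} → Fin p)) →
        (Finset.univ.inf' Finset.univ_nonempty d) * (1 - α) ≤ lam) ∧
    (∀ (i j : Fin p), i ≠ j → ∀ δ : ℝ, 0 < δ →
      (Finset.univ.inf' Finset.univ_nonempty d) * (1 - α) * |Jmat d R i j| /
          (spec ((Jmat d R).submatrix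
            (Subtype.val : {v : Fin p // v ≠ i ∧ v ≠ j} → Fin p) ![i, j]) ^ 2) >
        1 + δ →
      ∀ S : Finset (Fin p), (∀ v ∈ S, v ≠ i ∧ v ≠ j) →
        abs (((Jmat d R).submatrix ![i, j] ![i, j] -
            (Jmat d R).submatrix ![i, j]
              (Subtype.val : {v : Fin p // v ∉ S ∧ v ≠ i ∧ v ≠ j} → Fin p) *
            ((Jmat d R).submatrix
              (Subtype.val : {v : Fin p // v ∉ S ∧ v ≠ i ∧ v ≠ j} → Fin p)
              Subtype.val)⁻¹ *
            (Jmat d R).submatrix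
              (Subtype.val : {v : Fin p // v ∉ S ∧ v ≠ i ∧ v ≠ j} → Fin p) ![i, j] :
            Matrix (Fin 2) (Fin 2) ℝ)
          0 1) >
        δ / (1 + δ) * |Jmat d R i j|) := by
  set J := Jmat d R with hJ
  set c := Finset.univ.inf' Finset.univ_nonempty d * (1 - α) with hcdef
  have hc : 0 < c :=
    mul_pos ((Finset.lt_inf'_iff _).2 fun i _ => hd i) (sub_pos.2 hα1)
  have hquad : ∀ x : Fin p → ℝ, c * (x ⬝ᵥ x) ≤ x ⬝ᵥ (J *ᵥ x) :=
    le_dotProduct_Jmat_mulVec hd hα hα1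
  have hJsym : J.IsSymm := Jmat_isSymm d hsym
  refine ⟨fun B => ?_, fun i j _ δ hδ hlow S _ => ?_⟩
  · have hB := le_dotProduct_submatrix_mulVec hquad
      (Subtype.val_injective : Function.Injective (Subtype.val : {v : Fin p // v ∈ B} → Fin p))
    exact ⟨posDef_of_le_dotProduct_mulVec (hJsym.submatrix _) hc hB,
      fun _ hlam => le_of_mem_spectrum_of_le_dotProduct_mulVec hB hlam⟩
  · set K := spec (J.submatrix
      (Subtype.val : {v : Fin p // v ≠ i ∧ v ≠ j} → Fin p) ![i, j]) ^ 2 with hKdef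
    let f : {v : Fin p // v ∉ S ∧ v ≠ i ∧ v ≠ j} → Fin p := Subtype.val
    have hB := le_dotProduct_submatrix_mulVec hquad (f := f) Subtype.val_injective
    have hdet : IsUnit (J.submatrix f f).det :=
      (posDef_of_le_dotProduct_mulVec (hJsym.submatrix _) hc hB).det_pos.ne'.isUnit
    have hK0 : 0 ≤ K := sq_nonneg _
    have hcol (k : Fin 2) : (fun a => J (f a) (![i, j] k)) ⬝ᵥ
        (fun a => J (f a) (![i, j] k)) ≤ K :=
      (dotProduct_self_comp_le
        (f := fun a : {v : Fin p // v ∉ S ∧ v ≠ i ∧ v ≠ j} =>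
          (⟨a.1, a.2.2⟩ : {v : Fin p // v ≠ i ∧ v ≠ j}))
        (fun a b h => Subtype.ext (Subtype.mk.inj h))
        (fun a => J a.1 (![i, j] k))).trans
        (col_dotProduct_self_le_spec_sq (J.submatrix
          (Subtype.val : {v : Fin p // v ≠ i ∧ v ≠ j} → Fin p) ![i, j]) k)
    have hbound := mul_abs_dotProduct_inv_mulVec_le hdet hc hB hK0 (hcol 0) (hcol 1)
    have hentry : (J.submatrix ![i, j] ![i, j] -
        J.submatrix ![i, j] f * (J.submatrix f f)⁻¹ * J.submatrix f ![i, j]) 0 1 =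
        J i j - (fun a => J (f a) (![i, j] 0)) ⬝ᵥ
          ((J.submatrix f f)⁻¹ *ᵥ fun a => J (f a) (![i, j] 1)) := by
      rw [Matrix.sub_apply, Matrix.mul_assoc]
      simp only [Matrix.mul_apply, dotProduct, mulVec, Matrix.submatrix_apply,
        hJsym.apply (![i, j] 0)]
      rfl
    change δ / (1 + δ) * |J i j| < |(J.submatrix ![i, j] ![i, j] -
        J.submatrix ![i, j] f * (J.submatrix f f)⁻¹ * J.submatrix f ![i, j]) 0 1|
    rw [hentry]
    set t := (fun a => J (f a) (![i, j] 0)) ⬝ᵥ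
          ((J.submatrix f f)⁻¹ *ᵥ fun a => J (f a) (![i, j] 1))
    have hKpos : 0 < K := hK0.lt_of_ne fun h => by
      rw [← h, div_zero] at hlow
      linarith
    have hlow' : (1 + δ) * K < c * |J i j| := (lt_div_iff₀ hKpos).1 hlow
    have ht : (1 + δ) * |t| < |J i j| := by
      refine lt_of_mul_lt_mul_left ?_ hc.le
      nlinarith
    have htri := abs_sub_abs_le_abs_sub (J i j) t
    rw [div_mul_eq_mul_div, div_lt_iff₀ (by linarith)]
    nlinarith
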